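/- Let R be a finite set, let q : R → ℝ be nonnegative weights with ∑_{r ∈ R} q r = 1, and let a, b : R → (ℤ/2ℤ → ℤ/2ℤ) be families of local strategies. Say strategy r succeeds on input (s,t) if a r s + b r t = s·t. Then ∑_{r ∈ R} q r · (number of the four inputs (s,t) ∈ (ℤ/2ℤ)² on which r succeeds)/4 ≤ 3/4. That is, every probabilistic classical strategy for the CHSH game succeeds with probability at most 3/4 under the uniform input distribution. -/

import Mathlib

open Finset

theorem chsh_card_le (f g : ZMod 2 → ZMod 2) :
    (Finset.univ.filter
      (fun st : ZMod 2 × ZMod 2 => f st.1 + g st.2 = st.1 * st.2)).card ≤ 3 := by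
  by_contra hcon
  have hlt : ¬ (Finset.univ.filter
      (fun st : ZMod 2 × ZMod 2 => f st.1 + g st.2 = st.1 * st.2)).card <
      (Finset.univ : Finset (ZMod 2 × ZMod 2)).card := by
    have : (Finset.univ : Finset (ZMod 2 × ZMod 2)).card = 4 := by decide
    omega
  have hall : ∀ st : ZMod 2 × ZMod 2, f st.1 + g st.2 = st.1 * st.2 := by
    intro st
    by_contra hst
    exact hlt (Finset.card_lt_card (Finset.filter_ssubset.2 ⟨st, Finset.mem_univ _, hst⟩))
  have h00 := hall (0, 0)
  have h01 := hall (0, 1)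
  have h10 := hall (1, 0)
  have h11 := hall (1, 1)
  simp only at h00 h01 h10 h11
  generalize f 0 = w at *
  generalize f 1 = x at *
  generalize g 0 = y at *
  generalize g 1 = z at *
  clear hall hlt hcon
  revert w x y z
  decide

/-- Every probabilistic classical strategy for the CHSH game succeeds with
probability at most 3/4 under the uniform distribution on the four inputs. -/
theorem chsh_probabilistic_bound (R : Type) [Fintype R]
    (q : R → ℝ) (hq : ∀ r, 0 ≤ q r) (hsum : ∑ r, q r = 1)
    (a b : R → ZMod 2 → ZMod 2) :
    ∑ r, q r *
        (((Finset.univ.filter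
            (fun st : ZMod 2 × ZMod 2 => a r st.1 + b r st.2 = st.1 * st.2)).card : ℝ) / 4)
      ≤ 3 / 4 := by
  calc
    _ ≤ ∑ r, q r * (3 / 4) := by
      refine Finset.sum_le_sum fun r _ => mul_le_mul_of_nonneg_left ?_ (hq r)
      have h : ((Finset.univ.filter
            (fun st : ZMod 2 × ZMod 2 => a r st.1 + b r st.2 = st.1 * st.2)).card : ℝ) ≤ 3 := by
        exact_mod_cast chsh_card_le (a r) (b r)
      linarith
    _ = 3 / 4 := by rw [← Finset.sum_mul, hsum, one_mul]
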